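/- arXiv:math/0212052 — 3 statements merged into one kernel-verified Lean document; each statement's English description precedes it below -/
import Mathlib

section
/- Let V be a finite-dimensional real vector space and let {·,·} be a Jacobi bracket on C^∞(V,ℝ). Then {·,·} is homogeneous (i.e. Δ{f,g} = {Δf,g} + {f,Δg} − {f,g} for all f,g, where (Δf)(x) = Df(x)(x)) if and only if there exist a vector E ∈ V and a Lie algebra bracket [·,·]_* on the dual space V* such that for all f,g ∈ C^∞(V,ℝ) and x ∈ V: {f,g}(x) = [Df(x),Dg(x)]_*(x) + Df(x)(E)·Dg(x)(x) − Df(x)(x)·Dg(x)(E) + f(x)·Dg(x)(E) − g(x)·Df(x)(E), where [Df(x),Dg(x)]_*(x) denotes the evaluation of the covector [Df(x),Dg(x)]_* ∈ V* at x. (This expresses that E is an invariant vector field and Λ = Λ̄ + E∧Δ with Λ̄ the linear Poisson structure corresponding to the Lie algebra (V*,[·,·]_*).) -/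
/-- A Jacobi bracket on the smooth functions (those satisfying the predicate `S`)
of a space `N`: an ℝ-bilinear antisymmetric bracket satisfying the Jacobi identity
and the generalized Leibniz rule. -/
structure JacobiBracket (N : Type*) (S : (N → ℝ) → Prop) where
  br : (N → ℝ) → (N → ℝ) → N → ℝ
  smooth_br : ∀ f g, S f → S g → S (br f g)
  add_left : ∀ f g h, S f → S g → S h → br (f + g) h = br f h + br g h
  smul_left : ∀ (c : ℝ) (f g : N → ℝ), S f → S g → br (c • f) g = c • br f g
  antisymm : ∀ f g, S f → S g → br f g = -br g f
  jacobi : ∀ f g h, S f → S g → S h →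
    br f (br g h) + br g (br h f) + br h (br f g) = 0
  leibniz : ∀ f g h, S f → S g → S h →
    br f (g * h) = br f g * h + g * br f h - g * h * br f 1

/-- Smooth (C^∞) real functions on a normed space `V`. -/
def Cinf (V : Type*) [NormedAddCommGroup V] [NormedSpace ℝ V] : (V → ℝ) → Prop :=
  fun f => ContDiff ℝ (⊤ : ℕ∞) f

/-- Affine real functions on a real vector space: `x ↦ μ(x) + c` with `μ` linear. -/
def IsAffineFn {V : Type*} [AddCommGroup V] [Module ℝ V] (f : V → ℝ) : Prop :=
  ∃ (μ : V →ₗ[ℝ] ℝ) (c : ℝ), ∀ x, f x = μ x + c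

/-- A Jacobi bracket on `C^∞(V,ℝ)` is affine if the bracket of two affine functions
is affine. -/
def IsAffineJacobi {V : Type*} [NormedAddCommGroup V] [NormedSpace ℝ V]
    (J : JacobiBracket V (Cinf V)) : Prop :=
  ∀ a b, Cinf V a → Cinf V b → IsAffineFn a → IsAffineFn b → IsAffineFn (J.br a b)

/-- The Liouville (Euler) operator: `(Δf)(x) = Df(x)(x)`. -/
noncomputable def eulerOp {V : Type*} [NormedAddCommGroup V] [NormedSpace ℝ V]
    (f : V → ℝ) : V → ℝ :=
  fun x => fderiv ℝ f x x

open Set Filter Topology MeasureTheory intervalIntegral in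
/-- The integral over `[0, 1]` of a `C^n` function depending on a parameter is `C^n` in the
parameter. -/
theorem contDiff_parametric_integral.{u} {V : Type u} [NormedAddCommGroup V] [NormedSpace ℝ V]
    [FiniteDimensional ℝ V] (n : ℕ) : ∀ {F : Type u} [NormedAddCommGroup F] [NormedSpace ℝ F]
    [CompleteSpace F] {H : V → ℝ → F}, ContDiff ℝ n (Function.uncurry H) →
    ContDiff ℝ n (fun y => ∫ t in (0 : ℝ)..1, H y t) := by
  induction n with
  | zero =>
    intro F _ _ _ H hH
    simp only [Nat.cast_zero, contDiff_zero] at hH ⊢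
    exact continuous_parametric_intervalIntegral_of_continuous' hH 0 1
  | succ n ih =>
    intro F _ _ _ H hH
    push_cast at hH ⊢
    have hH' : ContDiff ℝ n (Function.uncurry fun (y : V) (t : ℝ) =>
        (fderiv ℝ (Function.uncurry H) (y, t)).comp (ContinuousLinearMap.inl ℝ V ℝ)) :=
      (hH.fderiv_right le_rfl).clm_comp contDiff_const
    have hHc : Continuous (Function.uncurry H) := hH.continuous
    refine contDiff_succ_iff_hasFDerivAt.2 ⟨_, ih hH', fun y₀ => ?_⟩
    obtain ⟨C, hC⟩ := ((isCompact_closedBall y₀ 1).prod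
      (isCompact_Icc (a := (0 : ℝ)) (b := 1))).exists_bound_of_continuousOn
        hH'.continuous.continuousOn
    refine hasFDerivAt_integral_of_dominated_of_fderiv_le (𝕜 := ℝ) (μ := volume)
      (F := H) (F' := fun y t => (fderiv ℝ (Function.uncurry H) (y, t)).comp
        (ContinuousLinearMap.inl ℝ V ℝ)) (bound := fun _ => C)
      (Metric.closedBall_mem_nhds y₀ one_pos) ?_ ?_ ?_ ?_ ?_ ?_
    · exact Eventually.of_forall fun y =>
        (hHc.comp (Continuous.prodMk_right y)).aestronglyMeasurable
    · exact (hHc.comp (Continuous.prodMk_right y₀)).intervalIntegrable _ _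
    · exact (hH'.continuous.comp (Continuous.prodMk_right y₀)).aestronglyMeasurable
    · refine Eventually.of_forall fun t ht y hy => hC (y, t) ⟨hy, ?_⟩
      rw [uIoc_of_le zero_le_one] at ht
      exact ⟨ht.1.le, ht.2⟩
    · exact intervalIntegrable_const
    · refine Eventually.of_forall fun t _ y _ => ?_
      have h1 : HasFDerivAt (Function.uncurry H) (fderiv ℝ (Function.uncurry H) (y, t)) (y, t) :=
        (hH.differentiable (by simp) _).hasFDerivAt
      exact h1.comp (f := fun e => (e, t)) y (hasFDerivAt_prodMk_left y t)

open Set MeasureTheory intervalIntegral in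
/-- Hadamard's lemma. -/
theorem Cinf.exists_eq_add_apply_sub {V : Type*} [NormedAddCommGroup V] [NormedSpace ℝ V]
    [FiniteDimensional ℝ V] {h : V → ℝ} (hh : Cinf V h) (x : V) :
    ∃ G : V → V →L[ℝ] ℝ, ContDiff ℝ (⊤ : ℕ∞) G ∧ G x = fderiv ℝ h x ∧
      ∀ y, h y = h x + G y (y - x) := by
  have hd : ContDiff ℝ (⊤ : ℕ∞) (fderiv ℝ h) := (contDiff_infty_iff_fderiv.1 hh).2
  have hc (y : V) : Continuous fun t : ℝ => fderiv ℝ h (x + t • (y - x)) :=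
    hd.continuous.comp (by fun_prop)
  refine ⟨fun y => ∫ t in (0 : ℝ)..1, fderiv ℝ h (x + t • (y - x)), ?_, by simp, fun y => ?_⟩
  · refine contDiff_infty.2 fun n => contDiff_parametric_integral n
      (H := fun y t => fderiv ℝ h (x + t • (y - x))) ?_
    exact (contDiff_infty.1 hd n).comp (f := fun p : V × ℝ => x + p.2 • (p.1 - x)) (by fun_prop)
  · beta_reduce
    rw [ContinuousLinearMap.intervalIntegral_apply ((hc y).intervalIntegrable _ _)]
    have hder (t : ℝ) : HasDerivAt (fun t : ℝ => h (x + t • (y - x)))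
        (fderiv ℝ h (x + t • (y - x)) (y - x)) t := by
      refine (hh.differentiable (by simp) _).hasFDerivAt.comp_hasDerivAt t ?_
      simpa using ((hasDerivAt_id t).smul_const (y - x)).const_add x
    rw [integral_eq_sub_of_hasDerivAt (fun t _ => hder t)
      (((hc y).clm_apply continuous_const).intervalIntegrable _ _)]
    simp

/-- A smooth function annihilated by the Euler operator is constant. -/
theorem Cinf.eq_of_fderiv_apply_self_eq_zero {V : Type*} [NormedAddCommGroup V] [NormedSpace ℝ V]
    {f : V → ℝ} (hf : Cinf V f) (h : ∀ x, fderiv ℝ f x x = 0) (x : V) : f x = f 0 := by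
  have hder (t : ℝ) : HasDerivAt (fun t : ℝ => f (t • x)) (fderiv ℝ f (t • x) x) t := by
    refine (hf.differentiable (by simp) _).hasFDerivAt.comp_hasDerivAt t ?_
    simpa using (hasDerivAt_id t).smul_const x
  obtain ⟨c, hc, hc'⟩ := exists_hasDerivAt_eq_slope (fun t : ℝ => f (t • x)) _ zero_lt_one
    (fun t _ => (hder t).continuousAt.continuousWithinAt) (fun t _ => hder t)
  have h0 := h (c • x)
  rw [map_smul, smul_eq_mul, hc'] at h0
  have := (mul_eq_zero.1 h0).resolve_left hc.1.ne'
  simp at this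
  linarith

theorem Cinf.hasFDerivAt {V : Type*} [NormedAddCommGroup V] [NormedSpace ℝ V]
    {f : V → ℝ} (hf : Cinf V f) (x : V) : HasFDerivAt f (fderiv ℝ f x) x :=
  (hf.differentiable (by simp) x).hasFDerivAt

theorem Cinf.hasFDerivAt_fderiv {V : Type*} [NormedAddCommGroup V] [NormedSpace ℝ V]
    {f : V → ℝ} (hf : Cinf V f) (x : V) :
    HasFDerivAt (fderiv ℝ f) (fderiv ℝ (fderiv ℝ f) x) x :=
  ((contDiff_infty_iff_fderiv.1 hf).2.differentiable (by simp) x).hasFDerivAt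

theorem Cinf.eulerOp {V : Type*} [NormedAddCommGroup V] [NormedSpace ℝ V]
    {f : V → ℝ} (hf : Cinf V f) : Cinf V (eulerOp f) :=
  (contDiff_infty_iff_fderiv.1 hf).2.clm_apply contDiff_id

theorem Cinf.fderiv_eulerOp {V : Type*} [NormedAddCommGroup V] [NormedSpace ℝ V]
    {f : V → ℝ} (hf : Cinf V f) (x : V) :
    fderiv ℝ (_root_.eulerOp f) x = fderiv ℝ (fderiv ℝ f) x x + fderiv ℝ f x := by
  have hsymm : IsSymmSndFDerivAt ℝ f x :=
    (ContDiff.contDiffAt hf).isSymmSndFDerivAt (by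
      simpa using WithTop.coe_le_coe.2 (le_top : (2 : ℕ∞) ≤ ⊤))
  have := ((hf.hasFDerivAt_fderiv x).clm_apply (hasFDerivAt_id x)).fderiv
  unfold _root_.eulerOp
  ext v
  simp only [id] at this
  rw [this]
  simp [hsymm v x, add_comm]

/-- A smooth function that is homogeneous of degree one is linear. -/
theorem Cinf.eq_fderiv_zero_of_eulerOp_eq {V : Type*} [NormedAddCommGroup V] [NormedSpace ℝ V]
    {f : V → ℝ} (hf : Cinf V f) (h : _root_.eulerOp f = f) : f = fderiv ℝ f 0 := by
  have h2 (x : V) : fderiv ℝ (fderiv ℝ f) x x = 0 := by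
    have := hf.fderiv_eulerOp x
    rw [h] at this
    simpa using this
  have h3 (x v : V) : fderiv ℝ f x v = fderiv ℝ f 0 v := by
    refine Cinf.eq_of_fderiv_apply_self_eq_zero (f := fun x => fderiv ℝ f x v)
      ((contDiff_infty_iff_fderiv.1 hf).2.clm_apply contDiff_const) (fun x => ?_) x
    rw [((hf.hasFDerivAt_fderiv x).clm_apply (hasFDerivAt_const v x)).fderiv]
    simp [h2]
  ext x
  rw [← h3 x x]
  exact (congrFun h x).symm

theorem Cinf.clm {V : Type*} [NormedAddCommGroup V] [NormedSpace ℝ V] (α : V →L[ℝ] ℝ) :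
    Cinf V α := α.contDiff

theorem Cinf.one {V : Type*} [NormedAddCommGroup V] [NormedSpace ℝ V] :
    Cinf V (1 : V → ℝ) := contDiff_const

theorem eulerOp_clm {V : Type*} [NormedAddCommGroup V] [NormedSpace ℝ V] (α : V →L[ℝ] ℝ) :
    eulerOp (α : V → ℝ) = α := by
  ext x
  simp [eulerOp]

theorem eulerOp_one {V : Type*} [NormedAddCommGroup V] [NormedSpace ℝ V] :
    eulerOp (1 : V → ℝ) = 0 := by
  ext x
  rw [eulerOp, show (1 : V → ℝ) = fun _ => 1 from rfl]
  simp

/-- A bilinear antisymmetric operation on a finite-dimensional space is continuous. -/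
theorem exists_clm_eq_of_antisymm {W : Type*} [NormedAddCommGroup W] [NormedSpace ℝ W]
    [FiniteDimensional ℝ W] {B : W → W → W} (hadd : ∀ α β γ, B (α + β) γ = B α γ + B β γ)
    (hsmul : ∀ (r : ℝ) (α β), B (r • α) β = r • B α β) (hanti : ∀ α β, B α β = -B β α) :
    ∃ B' : W →L[ℝ] W →L[ℝ] W, ∀ α β, B' α β = B α β := by
  let Bₗ : W →ₗ[ℝ] W →ₗ[ℝ] W := LinearMap.mk₂ ℝ B hadd hsmul
    (fun α β γ => by rw [hanti, hadd, hanti β, hanti γ, neg_add, neg_neg, neg_neg])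
    (fun c α β => by rw [hanti, hsmul, hanti β, smul_neg, neg_neg])
  exact ⟨LinearMap.toContinuousLinearMap
    (LinearMap.toContinuousLinearMap.toLinearMap ∘ₗ Bₗ), fun _ _ => rfl⟩

namespace JacobiBracket

theorem br_self {N : Type*} {S : (N → ℝ) → Prop} (J : JacobiBracket N S) {f : N → ℝ} (hf : S f) :
    J.br f f = 0 := self_eq_neg.1 (J.antisymm f f hf hf)

theorem add_right {N : Type*} {S : (N → ℝ) → Prop} (J : JacobiBracket N S)
    (hadd : ∀ f g, S f → S g → S (f + g)) {f g h : N → ℝ} (hf : S f) (hg : S g) (hh : S h) :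
    J.br h (f + g) = J.br h f + J.br h g := by
  rw [J.antisymm _ _ hh (hadd f g hf hg), J.add_left _ _ _ hf hg hh, J.antisymm _ _ hf hh,
    J.antisymm _ _ hg hh, neg_add, neg_neg, neg_neg]

variable {V : Type*} [NormedAddCommGroup V] [NormedSpace ℝ V] (J : JacobiBracket V (Cinf V))

theorem zero_left {f : V → ℝ} (hf : Cinf V f) : J.br 0 f = 0 := by
  have h := J.smul_left 0 0 f contDiff_const hf
  rwa [zero_smul, zero_smul] at h

theorem zero_right {f : V → ℝ} (hf : Cinf V f) : J.br f 0 = 0 := by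
  rw [J.antisymm f 0 hf contDiff_const, J.zero_left hf, neg_zero]

theorem smul_right (c : ℝ) {f g : V → ℝ} (hf : Cinf V f) (hg : Cinf V g) :
    J.br f (c • g) = c • J.br f g := by
  have hcg : Cinf V (c • g) := contDiff_const.smul hg
  rw [J.antisymm _ _ hf hcg, J.smul_left c g f hg hf, J.antisymm _ _ hg hf]
  simp

/-- The bracket with a function whose one-jet vanishes at `x` vanishes at `x`. -/
theorem br_apply_eq_zero_of_fderiv_eq_zero [FiniteDimensional ℝ V] {f h : V → ℝ}
    (hf : Cinf V f) (hh : Cinf V h) {x : V} (h0 : h x = 0) (h1 : fderiv ℝ h x = 0) :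
    J.br f h x = 0 := by
  obtain ⟨G, hG, hGx, hG'⟩ := hh.exists_eq_add_apply_sub x
  let b := Module.finBasis ℝ V
  let u (i : Fin (Module.finrank ℝ V)) : V → ℝ := fun y => G y (b i)
  let v (i : Fin (Module.finrank ℝ V)) : V → ℝ :=
    fun y => LinearMap.toContinuousLinearMap (b.coord i) (y - x)
  have hu i : Cinf V (u i) := hG.clm_apply contDiff_const
  have hv i : Cinf V (v i) :=
    (ContinuousLinearMap.contDiff _).comp (contDiff_id.sub contDiff_const)
  have huv i : Cinf V (u i * v i) := (hu i).mul (hv i)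
  have hsum : h = ∑ i, u i * v i := by
    ext y
    rw [hG' y, h0, zero_add]
    conv_lhs => rw [← b.sum_repr (y - x)]
    simp [u, v, mul_comm]
  have key (s : Finset (Fin (Module.finrank ℝ V))) :
      Cinf V (∑ i ∈ s, u i * v i) ∧ J.br f (∑ i ∈ s, u i * v i) x = 0 := by
    induction s using Finset.induction_on with
    | empty => exact ⟨contDiff_const, by simp [J.zero_right hf]⟩
    | insert i s hi ih =>
      rw [Finset.sum_insert hi]
      refine ⟨(huv i).add ih.1, ?_⟩
      rw [J.add_right (fun _ _ hf hg => hf.add hg) (huv i) ih.1 hf, Pi.add_apply, ih.2,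
        J.leibniz f _ _ hf (hu i) (hv i)]
      have hux : u i x = 0 := by simp [u, hGx, h1]
      have hvx : v i x = 0 := by simp [v]
      simp [hux, hvx]
  rw [hsum]
  exact (key _).2

/-- The value at `x` of a Jacobi bracket depends only on the one-jet at `x` of the second
argument. -/
theorem br_apply_eq [FiniteDimensional ℝ V] {f g : V → ℝ} (hf : Cinf V f) (hg : Cinf V g)
    (x : V) :
    J.br f g x = J.br f (fderiv ℝ g x) x + (g x - fderiv ℝ g x x) * J.br f 1 x := by
  set β := fderiv ℝ g x with hβ
  set c := g x - β x with hc
  have hβs : Cinf V (β : V → ℝ) := .clm β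
  have hcs : Cinf V (c • (1 : V → ℝ)) := contDiff_const.smul Cinf.one
  have hr : Cinf V (g - (⇑β + c • (1 : V → ℝ))) := hg.sub (hβs.add hcs)
  have h0 : J.br f (g - (⇑β + c • (1 : V → ℝ))) x = 0 := by
    refine J.br_apply_eq_zero_of_fderiv_eq_zero hf hr (by simp [hc]) ?_
    have : HasFDerivAt (g - (⇑β + c • (1 : V → ℝ))) (β - (β + 0)) x :=
      (hg.hasFDerivAt x).sub (β.hasFDerivAt.add (hasFDerivAt_const (c • (1 : ℝ)) x))
    rw [this.fderiv]
    simp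
  have hadd {f g : V → ℝ} (hf : Cinf V f) (hg : Cinf V g) : Cinf V (f + g) := hf.add hg
  have hg' : g = (⇑β + c • (1 : V → ℝ)) + (g - (⇑β + c • (1 : V → ℝ))) := by abel
  conv_lhs => rw [hg']
  rw [J.add_right (fun _ _ => hadd) (hadd hβs hcs) hr hf, J.add_right (fun _ _ => hadd) hβs hcs hf,
    J.smul_right c hf .one]
  simp [h0]

/-- A bracket given by the formula of a bilinear bracket on the dual and a constant vector field
is homogeneous. -/
theorem eulerOp_br_of_formula {J : JacobiBracket V (Cinf V)} (E : V)
    (B : (V →L[ℝ] ℝ) →L[ℝ] (V →L[ℝ] ℝ) →L[ℝ] (V →L[ℝ] ℝ))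
    (hJ : ∀ f g, Cinf V f → Cinf V g → ∀ x,
      J.br f g x = B (fderiv ℝ f x) (fderiv ℝ g x) x
        + fderiv ℝ f x E * fderiv ℝ g x x - fderiv ℝ f x x * fderiv ℝ g x E
        + f x * fderiv ℝ g x E - g x * fderiv ℝ f x E)
    {f g : V → ℝ} (hf : Cinf V f) (hg : Cinf V g) :
    eulerOp (J.br f g) = J.br (eulerOp f) g + J.br f (eulerOp g) - J.br f g := by
  ext x
  have hf₁ := hf.hasFDerivAt x
  have hg₁ := hg.hasFDerivAt x
  have hf₂ := hf.hasFDerivAt_fderiv x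
  have hg₂ := hg.hasFDerivAt_fderiv x
  have hid := hasFDerivAt_id (𝕜 := ℝ) x
  have hE := hasFDerivAt_const (𝕜 := ℝ) E x
  have hder := (((((B.hasFDerivAt_of_bilinear hf₂ hg₂).clm_apply hid).add
    ((hf₂.clm_apply hE).mul (hg₂.clm_apply hid))).sub
    ((hf₂.clm_apply hid).mul (hg₂.clm_apply hE))).add (hf₁.mul (hg₂.clm_apply hE))).sub
    (hg₁.mul (hf₂.clm_apply hE))
  have hbr := (hder.congr_of_eventuallyEq (.of_forall (hJ f g hf hg))).fderiv
  rw [Pi.sub_apply, Pi.add_apply, hJ _ _ hf.eulerOp hg, hJ _ _ hf hg.eulerOp, hJ _ _ hf hg,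
    hf.fderiv_eulerOp, hg.fderiv_eulerOp]
  simp only [eulerOp]
  rw [hbr]
  simp
  ring

end JacobiBracket

/-- a Jacobi bracket on `C^∞(V,ℝ)`, `V` finite-dimensional, is
homogeneous if and only if there are a vector `E ∈ V` and a Lie algebra bracket
`[·,·]_*` on the dual space `V*` such that
`{f,g}(x) = [Df(x),Dg(x)]_*(x) + Df(x)(E)·Dg(x)(x) − Df(x)(x)·Dg(x)(E)
 + f(x)·Dg(x)(E) − g(x)·Df(x)(E)`. -/
theorem stmt8 (V : Type*) [NormedAddCommGroup V] [NormedSpace ℝ V]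
    [FiniteDimensional ℝ V]
    (J : JacobiBracket V (Cinf V)) :
    (∀ f g, Cinf V f → Cinf V g →
      eulerOp (J.br f g) = J.br (eulerOp f) g + J.br f (eulerOp g) - J.br f g) ↔
    (∃ (E : V) (B : (V →L[ℝ] ℝ) → (V →L[ℝ] ℝ) → (V →L[ℝ] ℝ)),
      -- [·,·]_* is a Lie algebra bracket on V*
      (∀ α β γ, B (α + β) γ = B α γ + B β γ) ∧
      (∀ (r : ℝ) (α β), B (r • α) β = r • B α β) ∧
      (∀ α β, B α β = -B β α) ∧
      (∀ α β γ, B α (B β γ) + B β (B γ α) + B γ (B α β) = 0) ∧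
      -- the formula for the bracket
      (∀ f g, Cinf V f → Cinf V g → ∀ x,
        J.br f g x = B (fderiv ℝ f x) (fderiv ℝ g x) x
          + fderiv ℝ f x E * fderiv ℝ g x x - fderiv ℝ f x x * fderiv ℝ g x E
          + f x * fderiv ℝ g x E - g x * fderiv ℝ f x E)) := by
  constructor
  · intro hom
    have hadd : ∀ f g, Cinf V f → Cinf V g → Cinf V (f + g) := fun _ _ hf hg => hf.add hg
    have hlin (α β : V →L[ℝ] ℝ) : J.br α β = fderiv ℝ (J.br α β) 0 := by
      refine Cinf.eq_fderiv_zero_of_eulerOp_eq (J.smooth_br _ _ (.clm α) (.clm β)) ?_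
      rw [hom _ _ (.clm α) (.clm β), eulerOp_clm, eulerOp_clm, add_sub_cancel_right]
    have hconst (β : V →L[ℝ] ℝ) (x : V) : J.br 1 β x = J.br 1 β 0 := by
      refine Cinf.eq_of_fderiv_apply_self_eq_zero (J.smooth_br _ _ .one (.clm β)) (fun y => ?_) x
      have h := congrFun (hom _ _ .one (.clm β)) y
      rw [eulerOp_clm, eulerOp_one, J.zero_left (.clm β)] at h
      simpa [eulerOp] using h
    let L : Module.Dual ℝ (Module.Dual ℝ V) :=
      { toFun := fun β => J.br 1 (LinearMap.toContinuousLinearMap β) 0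
        map_add' := fun α β => by
          rw [map_add, FunLike.coe_add, J.add_right hadd (.clm _) (.clm _) .one]
          rfl
        map_smul' := fun c β => by
          rw [map_smul, FunLike.coe_smul, J.smul_right c .one (.clm _)]
          rfl }
    let E : V := (Module.evalEquiv ℝ V).symm L
    have hE (β : V →L[ℝ] ℝ) (x : V) : J.br 1 β x = β E := by
      rw [hconst β x]
      have h : Module.evalEquiv ℝ V E = L := (Module.evalEquiv ℝ V).apply_symm_apply L
      exact (LinearMap.congr_fun h (β : V →ₗ[ℝ] ℝ)).symm
    have hE' (β : V →L[ℝ] ℝ) (x : V) : J.br β 1 x = -β E := by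
      rw [J.antisymm _ _ (.clm β) .one, Pi.neg_apply, hE]
    refine ⟨E, fun α β => fderiv ℝ (J.br α β) 0, ?_, ?_, ?_, ?_, ?_⟩
    · intro α β γ
      apply DFunLike.coe_injective
      rw [FunLike.coe_add, ← hlin, ← hlin, ← hlin, FunLike.coe_add,
        J.add_left _ _ _ (.clm α) (.clm β) (.clm γ)]
    · intro r α β
      apply DFunLike.coe_injective
      rw [FunLike.coe_smul, ← hlin, ← hlin, FunLike.coe_smul,
        J.smul_left _ _ _ (.clm α) (.clm β)]
    · intro α β
      apply DFunLike.coe_injective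
      rw [FunLike.coe_neg, ← hlin, ← hlin, J.antisymm _ _ (.clm α) (.clm β)]
    · intro α β γ
      apply DFunLike.coe_injective
      rw [FunLike.coe_add, FunLike.coe_add, ← hlin, ← hlin, ← hlin, ← hlin, ← hlin, ← hlin]
      exact J.jacobi _ _ _ (.clm α) (.clm β) (.clm γ)
    · intro f g hf hg x
      have h₁ {k : V → ℝ} (hk : Cinf V k) : J.br f k x = J.br (fderiv ℝ f x) k x
          + (f x - fderiv ℝ f x x) * J.br 1 k x := by
        rw [J.antisymm _ _ hf hk, Pi.neg_apply, J.br_apply_eq hk hf,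
          J.antisymm _ _ hk (.clm _), J.antisymm _ _ hk .one]
        simp only [Pi.neg_apply]
        ring
      rw [J.br_apply_eq hf hg, h₁ (.clm _), h₁ .one, J.br_self .one, hE, hE', ← hlin]
      simp only [Pi.zero_apply]
      ring
  · rintro ⟨E, B, hadd, hsmul, hanti, -, hJ⟩ f g hf hg
    obtain ⟨B', hB'⟩ := exists_clm_eq_of_antisymm hadd hsmul hanti
    exact JacobiBracket.eulerOp_br_of_formula E B' (by simpa only [hB'] using hJ) hf hg
end

section
/- Let 𝔤 be a finite-dimensional real vector space, [·,·]_* a Lie algebra bracket on 𝔤*, X₀ ∈ 𝔤 with X₀ a 1-cocycle (α,β ↦ [α,β]_*(X₀) vanishes identically), and P₀ an antisymmetric bilinear form on 𝔤* satisfying P₀([α,β]_*,γ) + P₀([β,γ]_*,α) + P₀([γ,α]_*,β) = α(X₀)·P₀(β,γ) + β(X₀)·P₀(γ,α) + γ(X₀)·P₀(α,β) for all α,β,γ ∈ 𝔤* (i.e. d_*P₀ = −X₀∧P₀). Define for f,g ∈ C^∞(𝔤,ℝ) and x ∈ 𝔤: {f,g}(x) := [Df(x),Dg(x)]_*(x)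 + Df(x)(x)·Dg(x)(X₀) − Df(x)(X₀)·Dg(x)(x) − P₀(Df(x),Dg(x)) − f(x)·Dg(x)(X₀) + g(x)·Df(x)(X₀). Then {·,·} is a Jacobi bracket on C^∞(𝔤,ℝ) which is strongly affine: it is closed on affine functions, and {1,a} is the constant function −Da(X₀) for every affine function a. (This is the strongly-affine Jacobi structure Λ = Λ̄ + Δ∧X₀ − P₀, E = −X₀, with Λ̄ the linear Poisson structure of (𝔤*,[·,·]_*).) -/
/-- In finite dimension every linear functional on the dual is evaluation at a point. -/
theorem exists_eval_eq {V : Type*} [NormedAddCommGroup V] [NormedSpace ℝ V]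
    [FiniteDimensional ℝ V] (L : (V →L[ℝ] ℝ) →ₗ[ℝ] ℝ) : ∃ w : V, ∀ φ, L φ = φ w := by
  obtain ⟨w, hw⟩ := (Module.evalEquiv ℝ V).surjective
    (L ∘ₗ (LinearMap.toContinuousLinearMap : (V →ₗ[ℝ] ℝ) ≃ₗ[ℝ] (V →L[ℝ] ℝ)).toLinearMap)
  refine ⟨w, fun φ => ?_⟩
  have := LinearMap.congr_fun hw (φ : V →ₗ[ℝ] ℝ)
  exact this.symm

/-- A left-linear antisymmetric map on a finite-dimensional space is a continuous bilinear map. -/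
theorem exists_continuousBilinear {E F : Type*} [NormedAddCommGroup E] [NormedSpace ℝ E]
    [FiniteDimensional ℝ E] [NormedAddCommGroup F] [NormedSpace ℝ F] (B : E → E → F)
    (hadd : ∀ a b c, B (a + b) c = B a c + B b c) (hsmul : ∀ (r : ℝ) a b, B (r • a) b = r • B a b)
    (hanti : ∀ a b, B a b = -B b a) : ∃ T : E →L[ℝ] E →L[ℝ] F, ∀ a b, T a b = B a b :=
  ⟨(LinearMap.mk₂ ℝ B hadd hsmul
      (fun a b c => by rw [hanti, hadd, hanti b, hanti c, neg_add, neg_neg, neg_neg])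
      (fun r a b => by rw [hanti, hsmul, hanti b, smul_neg, neg_neg])).toContinuousBilinearMap,
    fun _ _ => rfl⟩

section AffineBracket

variable {V : Type*} [NormedAddCommGroup V] [NormedSpace ℝ V]

/-- The bracket attached to a bracket `B` and a form `P` on the dual, and a vector `X`. -/
noncomputable def affineBracket
    (B : (V →L[ℝ] ℝ) →L[ℝ] (V →L[ℝ] ℝ) →L[ℝ] (V →L[ℝ] ℝ))
    (P : (V →L[ℝ] ℝ) →L[ℝ] (V →L[ℝ] ℝ) →L[ℝ] ℝ) (X : V) (f k : V → ℝ) (x : V) : ℝ :=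
  B (fderiv ℝ f x) (fderiv ℝ k x) x
    + fderiv ℝ f x x * fderiv ℝ k x X - fderiv ℝ f x X * fderiv ℝ k x x
    - P (fderiv ℝ f x) (fderiv ℝ k x) - f x * fderiv ℝ k x X + k x * fderiv ℝ f x X

variable (B : (V →L[ℝ] ℝ) →L[ℝ] (V →L[ℝ] ℝ) →L[ℝ] (V →L[ℝ] ℝ))
  (P : (V →L[ℝ] ℝ) →L[ℝ] (V →L[ℝ] ℝ) →L[ℝ] ℝ) (X : V)

theorem Cinf.differentiable {f : V → ℝ} (hf : Cinf V f) : Differentiable ℝ f :=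
  ContDiff.differentiable hf (by simp)

theorem Cinf.contDiff_fderiv {f : V → ℝ} (hf : Cinf V f) :
    ContDiff ℝ (⊤ : ℕ∞) (fderiv ℝ f) :=
  ContDiff.fderiv_right hf (by simp)

theorem Cinf.affineBracket {f k : V → ℝ} (hf : Cinf V f) (hk : Cinf V k) :
    Cinf V (affineBracket B P X f k) := by
  have hf' := hf.contDiff_fderiv
  have hk' := hk.contDiff_fderiv
  unfold Cinf at *
  unfold _root_.affineBracket
  fun_prop

/-- The hamiltonian vector at `x` of a covector `α`, for the bivector part of the bracket. -/
theorem exists_hamiltonianVector [FiniteDimensional ℝ V] (x : V) (α : V →L[ℝ] ℝ) :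
    ∃ w : V, ∀ φ : V →L[ℝ] ℝ, φ w = B φ α x + φ x * α X - φ X * α x - P φ α := by
  obtain ⟨w, hw⟩ := exists_eval_eq
    ({ toFun := fun φ => B φ α x + φ x * α X - φ X * α x - P φ α
       map_add' := fun φ ψ => by simp; ring
       map_smul' := fun r φ => by simp; ring } : (V →L[ℝ] ℝ) →ₗ[ℝ] ℝ)
  exact ⟨w, fun φ => (hw φ).symm⟩

theorem fderiv_affineBracket_apply {f k : V → ℝ} (hf : Cinf V f) (hk : Cinf V k) (x v : V) :
    fderiv ℝ (affineBracket B P X f k) x v =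
      B (fderiv ℝ (fderiv ℝ f) x v) (fderiv ℝ k x) x
        + B (fderiv ℝ f x) (fderiv ℝ (fderiv ℝ k) x v) x + B (fderiv ℝ f x) (fderiv ℝ k x) v
        + fderiv ℝ (fderiv ℝ f) x v x * fderiv ℝ k x X
        + fderiv ℝ f x x * fderiv ℝ (fderiv ℝ k) x v X
        - fderiv ℝ (fderiv ℝ f) x v X * fderiv ℝ k x x
        - fderiv ℝ f x X * fderiv ℝ (fderiv ℝ k) x v x
        - P (fderiv ℝ (fderiv ℝ f) x v) (fderiv ℝ k x)
        - P (fderiv ℝ f x) (fderiv ℝ (fderiv ℝ k) x v)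
        - f x * fderiv ℝ (fderiv ℝ k) x v X + k x * fderiv ℝ (fderiv ℝ f) x v X := by
  have hf0 := (hf.differentiable x).hasFDerivAt
  have hk0 := (hk.differentiable x).hasFDerivAt
  have hf1 := ((hf.contDiff_fderiv.differentiable (by simp)) x).hasFDerivAt
  have hk1 := ((hk.contDiff_fderiv.differentiable (by simp)) x).hasFDerivAt
  have hid := hasFDerivAt_id (𝕜 := ℝ) x
  have hX := hasFDerivAt_const (𝕜 := ℝ) X x
  have key := ((((((((B.hasFDerivAt.comp x hf1).clm_apply hk1).clm_apply hid).add
    ((hf1.clm_apply hid).mul (hk1.clm_apply hX))).sub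
    ((hf1.clm_apply hX).mul (hk1.clm_apply hid))).sub
    ((P.hasFDerivAt.comp x hf1).clm_apply hk1)).sub
    (hf0.mul (hk1.clm_apply hX))).add (hk0.mul (hf1.clm_apply hX)))
  have key' : HasFDerivAt (affineBracket B P X f k) _ x := key
  rw [key'.fderiv]
  simp
  ring

variable {B P X}

/-- The covector `D{f,k}` in terms of second derivatives and hamiltonian vectors. -/
theorem fderiv_affineBracket_eq (hB : ∀ α β, B α β = -B β α) (hP : ∀ α β, P α β = -P β α)
    {f k : V → ℝ} (hf : Cinf V f) (hk : Cinf V k) {x u w : V}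
    (hu : ∀ φ : V →L[ℝ] ℝ, φ u =
      B φ (fderiv ℝ f x) x + φ x * fderiv ℝ f x X - φ X * fderiv ℝ f x x - P φ (fderiv ℝ f x))
    (hw : ∀ φ : V →L[ℝ] ℝ, φ w =
      B φ (fderiv ℝ k x) x + φ x * fderiv ℝ k x X - φ X * fderiv ℝ k x x - P φ (fderiv ℝ k x))
    (v : V) :
    fderiv ℝ (affineBracket B P X f k) x v =
      fderiv ℝ (fderiv ℝ f) x v (w + k x • X) - fderiv ℝ (fderiv ℝ k) x v (u + f x • X)
        + B (fderiv ℝ f x) (fderiv ℝ k x) v := by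
  rw [fderiv_affineBracket_apply B P X hf hk, map_add, map_add, map_smul, map_smul, hu, hw,
    hB (fderiv ℝ f x) (fderiv ℝ (fderiv ℝ k) x v), hP (fderiv ℝ f x)]
  simp only [neg_apply, smul_eq_mul]
  ring

theorem affineBracket_eq_hamiltonian (hB : ∀ α β, B α β = -B β α) (hP : ∀ α β, P α β = -P β α)
    {f : V → ℝ} (k : V → ℝ) {x u : V}
    (hu : ∀ φ : V →L[ℝ] ℝ, φ u =
      B φ (fderiv ℝ f x) x + φ x * fderiv ℝ f x X - φ X * fderiv ℝ f x x - P φ (fderiv ℝ f x)) :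
    affineBracket B P X f k x =
      -fderiv ℝ k x (u + f x • X) + k x * fderiv ℝ f x X := by
  rw [affineBracket, map_add, map_smul, hu, hB, hP]
  simp only [neg_apply, smul_eq_mul]
  ring

theorem affineBracket_antisymm (hB : ∀ α β, B α β = -B β α) (hP : ∀ α β, P α β = -P β α)
    (f k : V → ℝ) : affineBracket B P X f k = -affineBracket B P X k f := by
  ext x
  simp only [affineBracket, Pi.neg_apply]
  rw [hB, hP]
  simp only [neg_apply]
  ring

theorem affineBracket_leibniz {f k h : V → ℝ} (hk : Cinf V k) (hh : Cinf V h) :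
    affineBracket B P X f (k * h) = affineBracket B P X f k * h + k * affineBracket B P X f h
      - k * h * affineBracket B P X f 1 := by
  ext x
  have h1 : fderiv ℝ (1 : V → ℝ) x = 0 := (hasFDerivAt_const (1 : ℝ) x).fderiv
  simp only [affineBracket, Pi.mul_apply, Pi.add_apply, Pi.sub_apply, Pi.one_apply, h1,
    fderiv_mul (hk.differentiable x) (hh.differentiable x)]
  simp
  ring

theorem Cinf.isSymmSndFDerivAt {f : V → ℝ} (hf : Cinf V f) (x : V) :
    IsSymmSndFDerivAt ℝ f x :=
  ((ContDiff.contDiffAt hf).of_le (m := 2) (WithTop.coe_le_coe.2 (le_top : (2 : ℕ∞) ≤ ⊤))).isSymmSndFDerivAt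
    (by simp)

theorem affineBracket_jacobi [FiniteDimensional ℝ V]
    (hB : ∀ α β, B α β = -B β α) (hP : ∀ α β, P α β = -P β α)
    (hBj : ∀ α β γ, B α (B β γ) + B β (B γ α) + B γ (B α β) = 0)
    (hX : ∀ α β, B α β X = 0)
    (hPc : ∀ α β γ, P (B α β) γ + P (B β γ) α + P (B γ α) β
      = α X * P β γ + β X * P γ α + γ X * P α β)
    {f k h : V → ℝ} (hf : Cinf V f) (hk : Cinf V k) (hh : Cinf V h) :
    affineBracket B P X f (affineBracket B P X k h)
      + affineBracket B P X k (affineBracket B P X h f)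
      + affineBracket B P X h (affineBracket B P X f k) = 0 := by
  ext x
  obtain ⟨u, hu⟩ := exists_hamiltonianVector B P X x (fderiv ℝ f x)
  obtain ⟨v, hv⟩ := exists_hamiltonianVector B P X x (fderiv ℝ k x)
  obtain ⟨w, hw⟩ := exists_hamiltonianVector B P X x (fderiv ℝ h x)
  simp only [Pi.add_apply, Pi.zero_apply]
  rw [affineBracket_eq_hamiltonian hB hP (affineBracket B P X k h) hu,
    affineBracket_eq_hamiltonian hB hP (affineBracket B P X h f) hv,
    affineBracket_eq_hamiltonian hB hP (affineBracket B P X f k) hw,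
    fderiv_affineBracket_eq hB hP hk hh hv hw,
    fderiv_affineBracket_eq hB hP hh hf hw hu, fderiv_affineBracket_eq hB hP hf hk hu hv,
    (hf.isSymmSndFDerivAt x).eq (w + h x • X), (hk.isSymmSndFDerivAt x).eq (u + f x • X),
    (hh.isSymmSndFDerivAt x).eq (v + k x • X)]
  have hj := congrArg (fun φ : V →L[ℝ] ℝ => φ x)
    (hBj (fderiv ℝ f x) (fderiv ℝ k x) (fderiv ℝ h x))
  have hc := hPc (fderiv ℝ f x) (fderiv ℝ k x) (fderiv ℝ h x)
  rw [hB (fderiv ℝ f x) (B _ _), hB (fderiv ℝ k x) (B _ _), hB (fderiv ℝ h x) (B _ _)] at hj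
  simp only [add_apply, neg_apply,
    zero_apply] at hj
  simp only [map_add (B _ _), map_smul (B _ _), hX, hu, hv, hw, affineBracket, smul_zero]
  linear_combination hj + hc

end AffineBracket

/-- given a Lie algebra bracket `[·,·]_*` on the dual of a
finite-dimensional real vector space `𝔤`, a 1-cocycle `X₀ ∈ 𝔤`, and an antisymmetric
bilinear form `P₀` on `𝔤*` with `d_*P₀ = −X₀∧P₀`, the formula
`{f,g}(x) = [Df(x),Dg(x)]_*(x) + Df(x)(x)·Dg(x)(X₀) − Df(x)(X₀)·Dg(x)(x)
 − P₀(Df(x),Dg(x)) − f(x)·Dg(x)(X₀) + g(x)·Df(x)(X₀)`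
defines a Jacobi bracket on `C^∞(𝔤,ℝ)` which is strongly affine: it closes on affine
functions, and `{1,a}` is the constant function `−Da(X₀)` for every affine `a`. -/
theorem stmt13 (g : Type*) [NormedAddCommGroup g] [NormedSpace ℝ g]
    [FiniteDimensional ℝ g]
    (B : (g →L[ℝ] ℝ) → (g →L[ℝ] ℝ) → (g →L[ℝ] ℝ))
    (hBadd : ∀ α β γ, B (α + β) γ = B α γ + B β γ)
    (hBsmul : ∀ (r : ℝ) (α β), B (r • α) β = r • B α β)
    (hBanti : ∀ α β, B α β = -B β α)
    (hBjacobi : ∀ α β γ, B α (B β γ) + B β (B γ α) + B γ (B α β) = 0)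
    (X₀ : g)
    (hX₀ : ∀ α β, B α β X₀ = 0)
    (P₀ : (g →L[ℝ] ℝ) → (g →L[ℝ] ℝ) → ℝ)
    (hP₀add : ∀ α β γ, P₀ (α + β) γ = P₀ α γ + P₀ β γ)
    (hP₀smul : ∀ (r : ℝ) (α β), P₀ (r • α) β = r * P₀ α β)
    (hP₀anti : ∀ α β, P₀ α β = -P₀ β α)
    (hP₀cocycle : ∀ α β γ, P₀ (B α β) γ + P₀ (B β γ) α + P₀ (B γ α) β
      = α X₀ * P₀ β γ + β X₀ * P₀ γ α + γ X₀ * P₀ α β)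
    (Br : (g → ℝ) → (g → ℝ) → (g → ℝ))
    (hBr : Br = fun f g' x =>
      B (fderiv ℝ f x) (fderiv ℝ g' x) x
        + fderiv ℝ f x x * fderiv ℝ g' x X₀ - fderiv ℝ f x X₀ * fderiv ℝ g' x x
        - P₀ (fderiv ℝ f x) (fderiv ℝ g' x)
        - f x * fderiv ℝ g' x X₀ + g' x * fderiv ℝ f x X₀) :
    ∃ J : JacobiBracket g (Cinf g),
      J.br = Br ∧
      IsAffineJacobi J ∧
      (∀ a : g →ᵃ[ℝ] ℝ, J.br 1 ⇑a = fun _ => -(a.linear X₀)) := by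
  obtain ⟨T, hT⟩ := exists_continuousBilinear B hBadd hBsmul hBanti
  obtain ⟨Q, hQ⟩ := exists_continuousBilinear P₀ hP₀add hP₀smul hP₀anti
  obtain rfl : B = fun α β => T α β := by ext1 α; ext1 β; exact (hT α β).symm
  obtain rfl : P₀ = fun α β => Q α β := by ext1 α; ext1 β; exact (hQ α β).symm
  obtain rfl : Br = affineBracket T Q X₀ := hBr
  refine ⟨⟨affineBracket T Q X₀, fun f k hf hk => hf.affineBracket T Q X₀ hk, ?_, ?_,
    fun f k _ _ => affineBracket_antisymm hBanti hP₀anti f k,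
    fun f k h hf hk hh =>
      affineBracket_jacobi hBanti hP₀anti hBjacobi hX₀ hP₀cocycle hf hk hh,
    fun f k h _ hk hh => affineBracket_leibniz hk hh⟩, rfl, ?_, ?_⟩
  · intro f k h hf hk _
    ext x
    simp only [affineBracket, Pi.add_apply, fderiv_add (hf.differentiable x) (hk.differentiable x)]
    simp
    ring
  · intro c f k hf _
    ext x
    simp only [affineBracket, Pi.smul_apply, fderiv_const_smul (hf.differentiable x) c]
    simp
    ring
  · rintro a b - - ⟨μ, c, ha⟩ ⟨ν, d, hb⟩
    have hD (μ : g →ₗ[ℝ] ℝ) (c : ℝ) (a : g → ℝ) (ha : ∀ x, a x = μ x + c) (x : g) :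
        fderiv ℝ a x = μ.toContinuousLinearMap := by
      obtain rfl : a = fun x => μ.toContinuousLinearMap x + c := funext ha
      exact (μ.toContinuousLinearMap.hasFDerivAt.add_const c).fderiv
    refine ⟨(T μ.toContinuousLinearMap ν.toContinuousLinearMap : g →ₗ[ℝ] ℝ),
      -Q μ.toContinuousLinearMap ν.toContinuousLinearMap - c * ν X₀ + d * μ X₀, fun x => ?_⟩
    simp only [affineBracket, hD μ c a ha, hD ν d b hb, ha, hb]
    simp
    ring
  · intro a
    ext x
    have h1 : fderiv ℝ (1 : g → ℝ) x = 0 := (hasFDerivAt_const (1 : ℝ) x).fderiv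
    have h2 : fderiv ℝ a x = a.linear.toContinuousLinearMap := by
      rw [a.decomp]
      exact (a.linear.toContinuousLinearMap.hasFDerivAt.add_const (a 0)).fderiv
    simp only [affineBracket, h1, h2]
    simp
end

section
/- Let 𝔤 be a finite-dimensional real vector space with dim 𝔤 > 0 and let {·,·} be a strongly-affine Jacobi bracket on C^∞(𝔤,ℝ). Then: (i) for every affine function a there exist a unique linear endomorphism L_a of 𝔤 and a unique vector c_a ∈ 𝔤 such that ({a,f} + f·{1,a})(x) = Df(x)(L_a(x) + c_a) for all f ∈ C^∞(𝔤,ℝ) and x ∈ 𝔤 (the hamiltonian vector field of a is an affine vector field); and (ii) the map a ↦ (−L_a, −c_a) is a Lie algebra homomorphism from Aff(𝔤,ℝ), equipped with the restriction of {·,·}, to the Lie algebra aff(𝔤) of pairs (L,c) ∈ End(𝔤)×𝔤 with bracket [(L,c),(L',c')] = (L∘L' − L'∘L, L(c') − L'(c)). (Thus −X^{(Λ,E)} : 𝔤⁺ → Aff(𝔤,𝔤) is an affine representation of the Lie algebra 𝔤⁺ on 𝔤.) -/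
open Set Filter Topology MeasureTheory

section Hadamard

variable {V : Type*} [NormedAddCommGroup V] [NormedSpace ℝ V] [FiniteDimensional ℝ V]

theorem hasFDerivAt_intervalIntegral_of_contDiff {F : V × ℝ → ℝ} (hF : ContDiff ℝ 1 F)
    (a b : ℝ) (x₀ : V) :
    HasFDerivAt (fun x => ∫ t in a..b, F (x, t))
      (∫ t in a..b, (fderiv ℝ F (x₀, t)).comp (ContinuousLinearMap.inl ℝ V ℝ)) x₀ := by
  have hF' : Continuous fun q : V × ℝ =>
      (fderiv ℝ F q).comp (ContinuousLinearMap.inl ℝ V ℝ) :=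
    (hF.continuous_fderiv one_ne_zero).clm_comp continuous_const
  have hslice (x : V) : Continuous fun t : ℝ => F (x, t) :=
    hF.continuous.comp (by fun_prop)
  have : ProperSpace V := FiniteDimensional.proper ℝ V
  obtain ⟨C, hC⟩ := ((isCompact_closedBall x₀ 1).prod (isCompact_uIcc (a := a)
    (b := b))).exists_bound_of_continuousOn hF'.continuousOn
  refine intervalIntegral.hasFDerivAt_integral_of_dominated_of_fderiv_le (𝕜 := ℝ)
    (F := fun x t => F (x, t))
    (F' := fun x t => (fderiv ℝ F (x, t)).comp (ContinuousLinearMap.inl ℝ V ℝ))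
    (bound := fun _ => C) (Metric.closedBall_mem_nhds x₀ one_pos) ?_ ?_ ?_ ?_ ?_ ?_
  · exact Eventually.of_forall fun x => (hslice x).aestronglyMeasurable
  · exact (hslice x₀).intervalIntegrable _ _
  · exact (hF'.comp (by fun_prop : Continuous fun t : ℝ => (x₀, t))).aestronglyMeasurable
  · exact Eventually.of_forall fun t ht x hx => hC (x, t) ⟨hx, uIoc_subset_uIcc ht⟩
  · exact intervalIntegrable_const
  · exact Eventually.of_forall fun t _ x _ =>
      ((hF.differentiable one_ne_zero).differentiableAt.hasFDerivAt (x := (x, t))).comp x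
        (hasFDerivAt_prodMk_left x t)

theorem contDiff_nat_intervalIntegral (n : ℕ) (a b : ℝ) {F : V × ℝ → ℝ}
    (hF : ContDiff ℝ (⊤ : ℕ∞) F) :
    ContDiff ℝ n (fun x => ∫ t in a..b, F (x, t)) := by
  induction n generalizing F with
  | zero =>
    exact contDiff_zero.2 (intervalIntegral.continuous_parametric_intervalIntegral_of_continuous'
      (f := fun x t => F (x, t)) hF.continuous a b)
  | succ n ih =>
    have hF1 : ContDiff ℝ 1 F := hF.of_le (by exact_mod_cast le_top)
    have hd := hasFDerivAt_intervalIntegral_of_contDiff hF1 a b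
    push_cast
    refine contDiff_succ_iff_fderiv_apply.2 ⟨fun x => (hd x).differentiableAt, by simp, fun y => ?_⟩
    have hF' : Continuous fun q : V × ℝ =>
        (fderiv ℝ F q).comp (ContinuousLinearMap.inl ℝ V ℝ) :=
      (hF1.continuous_fderiv one_ne_zero).clm_comp continuous_const
    have heq : (fun x => fderiv ℝ (fun x => ∫ t in a..b, F (x, t)) x y)
        = fun x => ∫ t in a..b, (fun q => fderiv ℝ F q (y, 0)) (x, t) := by
      funext x
      have hint : IntervalIntegrable (fun t : ℝ =>
          (fderiv ℝ F (x, t)).comp (ContinuousLinearMap.inl ℝ V ℝ)) volume a b :=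
        (hF'.comp (by fun_prop : Continuous fun t : ℝ => (x, t))).intervalIntegrable _ _
      rw [(hd x).fderiv, ContinuousLinearMap.intervalIntegral_apply hint]
      simp
    rw [heq]
    exact ih ((hF.fderiv_right (m := (⊤ : ℕ∞)) (by exact_mod_cast le_top)).clm_apply
      contDiff_const)

theorem contDiff_intervalIntegral (a b : ℝ) {F : V × ℝ → ℝ} (hF : ContDiff ℝ (⊤ : ℕ∞) F) :
    ContDiff ℝ (⊤ : ℕ∞) (fun x => ∫ t in a..b, F (x, t)) :=
  contDiff_infty.2 fun n => contDiff_nat_intervalIntegral n a b hF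

/-- Hadamard's lemma. -/
theorem exists_contDiff_eq_add_sum {ι : Type*} [Fintype ι] (B : Module.Basis ι ℝ V) {f : V → ℝ}
    (hf : ContDiff ℝ (⊤ : ℕ∞) f) (p : V) :
    ∃ h : ι → V → ℝ, (∀ i, ContDiff ℝ (⊤ : ℕ∞) (h i)) ∧
      (∀ i, h i p = fderiv ℝ f p (B i)) ∧
      ∀ x, f x = f p + ∑ i, B.coord i (x - p) * h i x := by
  have hf' : ContDiff ℝ (⊤ : ℕ∞) (fderiv ℝ f) :=
    hf.fderiv_right (by exact_mod_cast le_top)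
  refine ⟨fun i x => ∫ t in (0 : ℝ)..1, fderiv ℝ f (p + t • (x - p)) (B i), fun i => ?_,
    fun i => by simp, fun x => ?_⟩
  · exact contDiff_intervalIntegral 0 1
      (F := fun q : V × ℝ => fderiv ℝ f (p + q.2 • (q.1 - p)) (B i))
      ((hf'.comp (by fun_prop)).clm_apply contDiff_const)
  · have hc (v : V) : Continuous fun t : ℝ => fderiv ℝ f (p + t • (x - p)) v :=
      (hf'.continuous.comp (by fun_prop)).clm_apply continuous_const
    have hftc : ∫ t in (0 : ℝ)..1, fderiv ℝ f (p + t • (x - p)) (x - p)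
        = f (p + (1 : ℝ) • (x - p)) - f (p + (0 : ℝ) • (x - p)) := by
      refine intervalIntegral.integral_eq_sub_of_hasDerivAt
        (f := fun t : ℝ => f (p + t • (x - p))) (fun t _ => ?_)
        ((hc _).intervalIntegrable _ _)
      have hline : HasDerivAt (fun t : ℝ => p + t • (x - p)) (x - p) t := by
        simpa using ((hasDerivAt_id t).smul_const (x - p)).const_add p
      exact ((hf.differentiable (by simp)).differentiableAt.hasFDerivAt).comp_hasDerivAt t hline
    have hsum : ∫ t in (0 : ℝ)..1, fderiv ℝ f (p + t • (x - p)) (x - p)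
        = ∑ i, B.coord i (x - p) * ∫ t in (0 : ℝ)..1, fderiv ℝ f (p + t • (x - p)) (B i) := by
      simp_rw [← intervalIntegral.integral_const_mul]
      have hint (i : ι) : IntervalIntegrable (fun t : ℝ =>
          B.coord i (x - p) * fderiv ℝ f (p + t • (x - p)) (B i)) volume 0 1 :=
        (continuous_const.mul (hc (B i))).intervalIntegrable _ _
      rw [← intervalIntegral.integral_finsetSum fun i _ => hint i]
      congr 1
      funext t
      have hv (l : V →L[ℝ] ℝ) (v : V) : l v = ∑ i, B.coord i v * l (B i) := by
        conv_lhs => rw [← B.sum_repr v, map_sum]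
        simp only [map_smul, smul_eq_mul, Module.Basis.coord_apply]
      exact hv _ _
    rw [← hsum, hftc]
    simp

end Hadamard

namespace Cinf

variable {V : Type*} [NormedAddCommGroup V] [NormedSpace ℝ V] {f h : V → ℝ}

theorem const (k : ℝ) : Cinf V (fun _ => k) := contDiff_const

theorem one_s16 : Cinf V (1 : V → ℝ) := contDiff_const

theorem add (hf : Cinf V f) (hh : Cinf V h) : Cinf V (f + h) := ContDiff.add hf hh

theorem mul (hf : Cinf V f) (hh : Cinf V h) : Cinf V (f * h) := ContDiff.mul hf hh

theorem neg (hf : Cinf V f) : Cinf V (-f) := ContDiff.neg hf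

theorem const_smul (k : ℝ) (hf : Cinf V f) : Cinf V (k • f) := ContDiff.const_smul k hf

theorem sum {ι : Type*} {s : Finset ι} {F : ι → V → ℝ} (hF : ∀ i, Cinf V (F i)) :
    Cinf V (∑ i ∈ s, F i) :=
  Finset.sum_induction F (Cinf V) (fun _ _ => add) (const 0) fun i _ => hF i

end Cinf

theorem LinearMap.isAffineFn {V : Type*} [AddCommGroup V] [Module ℝ V] (μ : V →ₗ[ℝ] ℝ) :
    IsAffineFn (μ : V → ℝ) :=
  ⟨μ, 0, by simp⟩

theorem AffineMap.isAffineFn {V : Type*} [AddCommGroup V] [Module ℝ V] (a : V →ᵃ[ℝ] ℝ) :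
    IsAffineFn (a : V → ℝ) :=
  ⟨a.linear, a 0, fun x => congrFun a.decomp x⟩

section Derivation

variable {V : Type*} [NormedAddCommGroup V] [NormedSpace ℝ V] [FiniteDimensional ℝ V]

theorem IsAffineFn.cinf {a : V → ℝ} (ha : IsAffineFn a) : Cinf V a := by
  obtain ⟨μ, k, h⟩ := ha
  have : a = fun x => LinearMap.toContinuousLinearMap μ x + k := funext fun x => by simp [h]
  rw [this]
  exact (ContinuousLinearMap.contDiff _).add contDiff_const

/-- A derivation of the smooth functions on a finite-dimensional space is a vector field. -/
theorem derivation_apply_eq_fderiv {ι : Type*} [Fintype ι] (B : Module.Basis ι ℝ V)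
    (D : (V → ℝ) → V → ℝ)
    (hadd : ∀ f h, Cinf V f → Cinf V h → D (f + h) = D f + D h)
    (hmul : ∀ f h, Cinf V f → Cinf V h → D (f * h) = D f * h + f * D h)
    (hconst : ∀ k : ℝ, D (fun _ => k) = 0) {f : V → ℝ} (hf : Cinf V f) (p : V) :
    D f p = fderiv ℝ f p (∑ i, D (B.coord i) p • B i) := by
  obtain ⟨h, hh, hp, hx⟩ := exists_contDiff_eq_add_sum B hf p
  have hsum (s : Finset ι) (F : ι → V → ℝ) (hF : ∀ i, Cinf V (F i)) :
      D (∑ i ∈ s, F i) = ∑ i ∈ s, D (F i) := by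
    classical
    induction s using Finset.induction_on with
    | empty => exact hconst 0
    | insert i s hi ih =>
      rw [Finset.sum_insert hi, Finset.sum_insert hi, hadd _ _ (hF i) (Cinf.sum hF), ih]
  let u (i : ι) : V → ℝ := ⇑(B.coord i) + fun _ => -B.coord i p
  have hcoord (i : ι) : Cinf V (B.coord i) := (B.coord i).isAffineFn.cinf
  have hu (i : ι) : Cinf V (u i) := (hcoord i).add (Cinf.const _)
  have hDu (i : ι) : D (u i) = D (B.coord i) := by
    rw [hadd _ _ (hcoord i) (Cinf.const _), hconst, add_zero]
  have hup (i : ι) : u i p = 0 := by simp [u]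
  have huh (i : ι) : Cinf V (u i * h i) := (hu i).mul (hh i)
  have hfe : f = (fun _ => f p) + ∑ i, u i * h i := by
    funext x
    rw [hx x]
    simp [u, sub_eq_add_neg]
  have hDf : D f = ∑ i, D (u i * h i) := by
    conv_lhs => rw [hfe]
    rw [hadd _ _ (Cinf.const _) (Cinf.sum huh), hconst, zero_add, hsum _ _ huh]
  rw [hDf, Finset.sum_apply, map_sum]
  refine Finset.sum_congr rfl fun i _ => ?_
  rw [hmul _ _ (hu i) (hh i), hDu]
  simp [hup, hp]

end Derivation

namespace JacobiBracket

variable {V : Type*} [NormedAddCommGroup V] [NormedSpace ℝ V] (J : JacobiBracket V (Cinf V))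

/-- The hamiltonian operator of a smooth function. -/
def ham (a f : V → ℝ) : V → ℝ := J.br a f + f * J.br 1 a

variable {J} {a b f h : V → ℝ}

theorem br_add_right (ha : Cinf V a) (hf : Cinf V f) (hh : Cinf V h) :
    J.br a (f + h) = J.br a f + J.br a h := by
  rw [J.antisymm _ _ ha (hf.add hh), J.add_left _ _ _ hf hh ha, J.antisymm _ _ hf ha,
    J.antisymm _ _ hh ha]
  abel

theorem br_smul_right (ha : Cinf V a) (hf : Cinf V f) (k : ℝ) :
    J.br a (k • f) = k • J.br a f := by
  rw [J.antisymm _ _ ha (hf.const_smul k), J.smul_left _ _ _ hf ha, J.antisymm _ _ hf ha]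
  simp

theorem br_neg_right (ha : Cinf V a) (hf : Cinf V f) : J.br a (-f) = -J.br a f := by
  simpa using br_smul_right (J := J) ha hf (-1)

theorem ham_eq (ha : Cinf V a) (f : V → ℝ) : J.ham a f = J.br a f - f * J.br a 1 := by
  rw [ham, J.antisymm _ _ Cinf.one_s16 ha]
  ring

theorem cinf_ham (ha : Cinf V a) (hf : Cinf V f) : Cinf V (J.ham a f) :=
  (J.smooth_br _ _ ha hf).add (hf.mul (J.smooth_br _ _ Cinf.one_s16 ha))

theorem ham_add (ha : Cinf V a) (hf : Cinf V f) (hh : Cinf V h) :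
    J.ham a (f + h) = J.ham a f + J.ham a h := by
  rw [ham, ham, ham, br_add_right ha hf hh]
  ring

theorem ham_mul (ha : Cinf V a) (hf : Cinf V f) (hh : Cinf V h) :
    J.ham a (f * h) = J.ham a f * h + f * J.ham a h := by
  rw [ham_eq ha, ham_eq ha, ham_eq ha, J.leibniz _ _ _ ha hf hh]
  ring

theorem ham_const (ha : Cinf V a) (k : ℝ) : J.ham a (fun _ => k) = 0 := by
  have hk : (fun _ : V => k) = k • (1 : V → ℝ) := by
    funext x
    simp
  rw [ham_eq ha, hk, br_smul_right ha Cinf.one_s16]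
  simp

theorem br_br_left (ha : Cinf V a) (hb : Cinf V b) (hf : Cinf V f) :
    J.br (J.br a b) f = J.br a (J.br b f) - J.br b (J.br a f) := by
  have hj := J.jacobi a b f ha hb hf
  rw [J.antisymm f a hf ha, br_neg_right hb (J.smooth_br _ _ ha hf),
    J.antisymm f _ hf (J.smooth_br _ _ ha hb)] at hj
  linear_combination -hj

theorem ham_ham (ha : Cinf V a) (hb : Cinf V b) (hf : Cinf V f) :
    J.ham a (J.ham b f) = J.br a (J.br b f) - J.br a f * J.br b 1 - f * J.br a (J.br b 1)
      + f * J.br b 1 * J.br a 1 - J.br b f * J.br a 1 + f * J.br b 1 * J.br a 1 := by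
  have hbf := J.smooth_br _ _ hb hf
  have hb1 := J.smooth_br _ _ hb Cinf.one_s16
  rw [ham_eq ha, ham_eq hb, sub_eq_add_neg (J.br b f), br_add_right ha hbf (hf.mul hb1).neg,
    br_neg_right ha (hf.mul hb1), J.leibniz _ _ _ ha hf hb1]
  ring

/-- Hamiltonian operators represent the bracket by commutators. -/
theorem ham_br (ha : Cinf V a) (hb : Cinf V b) (hf : Cinf V f) :
    J.ham (J.br a b) f = J.ham a (J.ham b f) - J.ham b (J.ham a f) := by
  rw [ham_ham ha hb hf, ham_ham hb ha hf, ham_eq (J.smooth_br _ _ ha hb), br_br_left ha hb hf,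
    br_br_left ha hb Cinf.one_s16]
  ring

end JacobiBracket

theorem eq_and_eq_of_affine_eq {V : Type*} [AddCommGroup V] [Module ℝ V] {L L' : V →ₗ[ℝ] V}
    {c c' : V} (h : ∀ x, L x + c = L' x + c') : L = L' ∧ c = c' := by
  have hc : c = c' := by simpa using h 0
  exact ⟨LinearMap.ext fun x => by simpa [hc] using h x, hc⟩

theorem eq_of_forall_linear_eq {V : Type*} [AddCommGroup V] [Module ℝ V] {v w : V}
    (h : ∀ μ : V →ₗ[ℝ] ℝ, μ v = μ w) : v = w :=
  sub_eq_zero.1 ((Module.forall_dual_apply_eq_zero_iff ℝ (v - w)).1 fun μ => by simp [h])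

theorem fderiv_linearMap_apply {V : Type*} [NormedAddCommGroup V] [NormedSpace ℝ V]
    [FiniteDimensional ℝ V] (μ : V →ₗ[ℝ] ℝ) (x v : V) : fderiv ℝ μ x v = μ v :=
  congrArg (fun l : V →L[ℝ] ℝ => l v) (LinearMap.toContinuousLinearMap μ).fderiv

theorem exists_affine_hamiltonian_vectorField {V : Type*} [NormedAddCommGroup V]
    [NormedSpace ℝ V] [FiniteDimensional ℝ V] (J : JacobiBracket V (Cinf V)) {a : V → ℝ}
    (ha : Cinf V a) (hlin : ∀ μ : V →ₗ[ℝ] ℝ, IsAffineFn (J.ham a μ)) :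
    ∃ (L : V →ₗ[ℝ] V) (c : V), ∀ f, Cinf V f → ∀ x, J.ham a f x = fderiv ℝ f x (L x + c) := by
  let B := Module.finBasis ℝ V
  choose μ k hμ using fun i => hlin (B.coord i)
  refine ⟨∑ i, (μ i).smulRight (B i), ∑ i, k i • B i, fun f hf x => ?_⟩
  rw [derivation_apply_eq_fderiv B (J.ham a) (fun _ _ => JacobiBracket.ham_add ha)
    (fun _ _ => JacobiBracket.ham_mul ha) (JacobiBracket.ham_const ha) hf x]
  simp [hμ, add_smul, Finset.sum_add_distrib]

/-- for a strongly-affine Jacobi bracket on `C^∞(𝔤,ℝ)`, `𝔤`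
finite-dimensional of positive dimension: (i) the hamiltonian vector field of each
affine function `a` is the affine vector field `x ↦ L_a(x) + c_a` for a unique
`(L_a, c_a) ∈ End(𝔤)×𝔤`; (ii) `a ↦ (−L_a, −c_a)` is a Lie algebra homomorphism from
`Aff(𝔤,ℝ)` (with the restricted bracket) to `aff(𝔤)` with the bracket
`[(L,c),(L',c')] = (L∘L' − L'∘L, L(c') − L'(c))`. -/
theorem stmt16 (g : Type*) [NormedAddCommGroup g] [NormedSpace ℝ g]
    [FiniteDimensional ℝ g] (hg : 0 < Module.finrank ℝ g)
    (J : JacobiBracket g (Cinf g)) (hJ : IsAffineJacobi J)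
    (hstrong : ∀ a b, Cinf g a → Cinf g b → IsAffineFn a → IsAffineFn b →
      IsAffineFn (fun x => J.br a b x + b x * J.br 1 a x)) :
    ∃ (L : (g →ᵃ[ℝ] ℝ) → (g →ₗ[ℝ] g)) (c : (g →ᵃ[ℝ] ℝ) → g),
      -- (i) the hamiltonian vector field of `a` is `x ↦ L_a x + c_a`
      (∀ (a : g →ᵃ[ℝ] ℝ) (f : g → ℝ), Cinf g f → ∀ x,
        J.br ⇑a f x + f x * J.br 1 ⇑a x = fderiv ℝ f x (L a x + c a)) ∧
      -- (i) uniqueness of `(L_a, c_a)`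
      (∀ (a : g →ᵃ[ℝ] ℝ) (L' : g →ₗ[ℝ] g) (c' : g),
        (∀ f, Cinf g f → ∀ x,
          J.br ⇑a f x + f x * J.br 1 ⇑a x = fderiv ℝ f x (L' x + c')) →
        L' = L a ∧ c' = c a) ∧
      -- the bracket of two affine functions is again affine
      (∀ a b : g →ᵃ[ℝ] ℝ, ∃ ab : g →ᵃ[ℝ] ℝ, J.br ⇑a ⇑b = ⇑ab) ∧
      -- (ii) `a ↦ (−L_a, −c_a)` is a Lie algebra homomorphism into aff(𝔤)
      (∀ a b ab : g →ᵃ[ℝ] ℝ, J.br ⇑a ⇑b = ⇑ab →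
        ((-L ab : g →ₗ[ℝ] g), -c ab)
          = ((-L a) ∘ₗ (-L b) - (-L b) ∘ₗ (-L a),
             (-L a) (-c b) - (-L b) (-c a))) := by
  have key (a : g →ᵃ[ℝ] ℝ) : ∃ (L : g →ₗ[ℝ] g) (c : g), ∀ f, Cinf g f → ∀ x,
      J.ham ⇑a f x = fderiv ℝ f x (L x + c) :=
    exists_affine_hamiltonian_vectorField J a.isAffineFn.cinf fun μ =>
      hstrong _ _ a.isAffineFn.cinf μ.isAffineFn.cinf a.isAffineFn μ.isAffineFn
  choose L c hLc using key
  have hlin (a : g →ᵃ[ℝ] ℝ) (μ : g →ₗ[ℝ] ℝ) (x : g) : J.ham ⇑a μ x = μ (L a x + c a) := by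
    rw [hLc a _ μ.isAffineFn.cinf, fderiv_linearMap_apply]
  refine ⟨L, c, hLc, fun a L' c' h' => ?_, fun a b => ?_, fun a b ab hab => ?_⟩
  · refine eq_and_eq_of_affine_eq fun x => eq_of_forall_linear_eq fun μ => ?_
    rw [← hlin, ← fderiv_linearMap_apply μ x, ← h' _ μ.isAffineFn.cinf]
    rfl
  · obtain ⟨μ, k, h⟩ := hJ _ _ a.isAffineFn.cinf b.isAffineFn.cinf a.isAffineFn b.isAffineFn
    exact ⟨μ.toAffineMap + AffineMap.const ℝ g k, funext fun x => by simp [h]⟩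
  · have hcomp (a b : g →ᵃ[ℝ] ℝ) (μ : g →ₗ[ℝ] ℝ) (x : g) :
        J.ham ⇑a (J.ham ⇑b μ) x = μ (L b (L a x + c a)) := by
      have hb : J.ham ⇑b μ = ⇑(μ ∘ₗ L b) + fun _ => μ (c b) := by
        funext y
        simp [hlin]
      rw [hb, JacobiBracket.ham_add a.isAffineFn.cinf (μ ∘ₗ L b).isAffineFn.cinf (Cinf.const _),
        JacobiBracket.ham_const a.isAffineFn.cinf, add_zero, hlin]
      rfl
    have h : L ab = L b ∘ₗ L a - L a ∘ₗ L b ∧ c ab = L b (c a) - L a (c b) := by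
      refine eq_and_eq_of_affine_eq fun x => eq_of_forall_linear_eq fun μ => ?_
      rw [← hlin, ← hab, JacobiBracket.ham_br a.isAffineFn.cinf b.isAffineFn.cinf
        μ.isAffineFn.cinf, Pi.sub_apply, hcomp, hcomp]
      simp only [map_add, map_sub, LinearMap.sub_apply, LinearMap.comp_apply]
      ring
    rw [h.1, h.2]
    ext1
    · ext x
      simp
    · simp
end
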